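/- Let d be a positive integer and n : Fin d → ℕ with each n_l ≥ 1. Let X : (Π l, Fin n_l) → ℂ be a rank-d array, and define the extended array W indexed by [2n_1] × ⋯ × [2n_d] by W_j = X_{(e(j_1), …, e(j_d))}, where for each coordinate e(j_l) = j_l if j_l < n_l and e(j_l) = 2n_l − 1 − j_l if n_l ≤ j_l < 2n_l. Then for every multi-index k with 0 ≤ k_l < n_l for all l, the rank-d DCT-II of X satisfies Σ_j X_j ∏_{l=1}^d cos((2j_l+1)·k_l·π/(2n_l)) = (∏_{l=1}^d (1/2)·exp(−π i k_l/(2n_l))) · Z_k, where Z is the rank-d discrete Fourier transform of size (2n_1, …, 2n_d) applied to W. (This is the correctness of the rank-d parallel DCT-II algorithm obtained as the tensor product of rank-1 DCT-II algorithms.) -/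

import Mathlib

open Finset

/-- The rank-`d` discrete Fourier transform of size `m = (m_1, …, m_d)`:
`Z_k = ∑_j W_j ∏_l ω_{m_l}^{j_l k_l}` with `ω_m = exp(-2πi/m)`. -/
noncomputable def dftd (d : ℕ) (m : Fin d → ℕ) (W : (∀ l, Fin (m l)) → ℂ) :
    (∀ l, Fin (m l)) → ℂ :=
  fun k => ∑ j : ∀ l, Fin (m l),
    W j * ∏ l, Complex.exp (-2 * Real.pi * Complex.I / (m l)) ^ ((j l).val * (k l).val)

/-- The symmetric folding `Fin (2 * n) → Fin n`, sending `i` to `i` or to `2n - 1 - i`. -/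
def dctFold (n : ℕ) (i : Fin (2 * n)) : Fin n :=
  if h : i.val < n then ⟨i.val, h⟩ else ⟨2 * n - 1 - i.val, by omega⟩

theorem sum_filter_dctFold_eq {M : Type*} [AddCommMonoid M] (n : ℕ) (x : Fin n)
    (f : ℕ → M) :
    ∑ i : Fin (2 * n) with dctFold n i = x, f i.val = f x.val + f (2 * n - 1 - x.val) := by
  have hx := x.isLt
  have hfiber : (univ.filter fun i : Fin (2 * n) => dctFold n i = x) =
      {⟨x.val, by omega⟩, ⟨2 * n - 1 - x.val, by omega⟩} := by
    ext i
    have hi := i.isLt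
    simp only [dctFold, mem_filter, mem_univ, true_and, mem_insert, mem_singleton, Fin.ext_iff]
    split_ifs <;> simp only <;> omega
  rw [hfiber, sum_pair]
  simp only [ne_eq, Fin.mk.injEq]
  omega

/-- Summing a separable kernel against an array pulled back along coordinatewise maps. -/
theorem sum_comp_mul_prod {ι R : Type*} {α β : ι → Type*} [Fintype ι] [DecidableEq ι]
    [∀ l, Fintype (α l)] [∀ l, Fintype (β l)] [∀ l, DecidableEq (β l)] [CommSemiring R]
    (e : ∀ l, α l → β l) (X : (∀ l, β l) → R) (f : ∀ l, α l → R) :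
    ∑ j : ∀ l, α l, X (fun l => e l (j l)) * ∏ l, f l (j l) =
      ∑ x : ∀ l, β l, X x * ∏ l, ∑ i : α l with e l i = x l, f l i := by
  rw [← sum_fiberwise univ (fun j : ∀ l, α l => fun l => e l (j l))]
  refine sum_congr rfl fun x _ => ?_
  rw [prod_univ_sum, mul_sum]
  refine sum_congr ?_ ?_
  · ext j
    simp [Fintype.mem_piFinset, funext_iff]
  · intro j hj
    have hjx : (fun l => e l (j l)) = x := by
      funext l
      simpa using Fintype.mem_piFinset.1 hj l
    rw [hjx]

theorem cos_eq_half_exp_mul_dft_kernel (n x k : ℕ) (hx : x < n) :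
    (Real.cos ((2 * (x : ℝ) + 1) * k * Real.pi / (2 * n)) : ℂ) =
      (1 / 2) * Complex.exp (-Real.pi * Complex.I * k / (2 * n)) *
        (Complex.exp (-2 * Real.pi * Complex.I / (2 * n : ℕ)) ^ (x * k) +
          Complex.exp (-2 * Real.pi * Complex.I / (2 * n : ℕ)) ^ ((2 * n - 1 - x) * k)) := by
  have hn : (n : ℂ) ≠ 0 := by
    exact_mod_cast (by omega : n ≠ 0)
  have hsub : ((2 * n - 1 - x : ℕ) : ℂ) = 2 * n - 1 - x := by
    rw [Nat.cast_sub (by omega), Nat.cast_sub (by omega)]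
    push_cast
    ring
  have hperiod : Complex.exp (-(k * (2 * Real.pi * Complex.I))) = 1 := by
    rw [Complex.exp_neg, Complex.exp_nat_mul_two_pi_mul_I, inv_one]
  rw [Complex.ofReal_cos, Complex.cos, mul_assoc (1 / 2 : ℂ), mul_add (Complex.exp _),
    ← Complex.exp_nat_mul, ← Complex.exp_nat_mul, ← Complex.exp_add, ← Complex.exp_add]
  push_cast
  rw [hsub]
  have hlow : -(Real.pi : ℂ) * Complex.I * k / (2 * n) +
      x * k * (-2 * Real.pi * Complex.I / (2 * n)) =
      -((2 * x + 1) * k * Real.pi / (2 * n)) * Complex.I := by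
    field_simp
    ring
  have hhigh : -(Real.pi : ℂ) * Complex.I * k / (2 * n) +
      (2 * n - 1 - x) * k * (-2 * Real.pi * Complex.I / (2 * n)) =
      (2 * x + 1) * k * Real.pi / (2 * n) * Complex.I +
        -(k * (2 * Real.pi * Complex.I)) := by
    field_simp
    ring
  rw [hlow, hhigh, Complex.exp_add, hperiod]
  ring

/-- Correctness of the rank-`d` DCT-II algorithm obtained as the tensor product
of rank-1 DCT-II algorithms: with the symmetric extension
`W_j = X_{(e(j_1),…,e(j_d))}`, `e(j_l) = j_l` if `j_l < n_l` and
`e(j_l) = 2n_l − 1 − j_l` otherwise, one has for every multi-index `k` with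
`k_l < n_l`:
`∑_j X_j ∏_l cos((2j_l+1)k_lπ/(2n_l))
  = (∏_l ½·exp(−πik_l/(2n_l))) · (F_{2n_1} ⊗ ⋯ ⊗ F_{2n_d})(W)_k`. -/
theorem dctII_rank_d_via_dft (d : ℕ) (hd : 0 < d) (n : Fin d → ℕ) (hn : ∀ l, 0 < n l)
    (X : (∀ l, Fin (n l)) → ℂ) (k : ∀ l, Fin (n l)) :
    ∑ j : ∀ l, Fin (n l),
        X j * ∏ l, (Real.cos ((2 * ((j l).val : ℝ) + 1) * (k l).val * Real.pi / (2 * n l)) : ℂ) =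
      (∏ l, (1 / 2) * Complex.exp (-Real.pi * Complex.I * (k l).val / (2 * n l))) *
        dftd d (fun l => 2 * n l)
          (fun j => X (fun l => if h : (j l).val < n l then ⟨(j l).val, h⟩
            else ⟨2 * n l - 1 - (j l).val, by
              have h2 : (j l).val < 2 * n l := (j l).isLt
              omega⟩))
          (fun l => ⟨(k l).val, by show (k l).val < 2 * n l; have := (k l).isLt; omega⟩) := by
  have hfold := sum_comp_mul_prod (fun l => dctFold (n l)) X (fun l i =>
    Complex.exp (-2 * Real.pi * Complex.I / (2 * n l : ℕ)) ^ (i.val * (k l).val))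
  refine Eq.trans ?_ (congrArg _ hfold.symm)
  rw [mul_sum]
  refine sum_congr rfl fun x _ => ?_
  rw [mul_left_comm, ← prod_mul_distrib]
  congr 1
  refine prod_congr rfl fun l _ => ?_
  rw [sum_filter_dctFold_eq (n l) (x l) fun i =>
    Complex.exp (-2 * Real.pi * Complex.I / (2 * n l : ℕ)) ^ (i * (k l).val)]
  exact cos_eq_half_exp_mul_dft_kernel (n l) (x l) (k l) (x l).isLt
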